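/- There exists a constant C < ∞ such that for all x ∈ ℝ, u(x) := ∫₀¹ p_s(x) ds ≤ C/(1 + x²). -/

import Mathlib

noncomputable def pdens (ψ : ℝ → ℝ) (s x : ℝ) : ℝ :=
  (1 / Real.pi) * ∫ p in Set.Ioi (0:ℝ), Real.cos (p * x) * Real.exp (-s * ψ p)

open MeasureTheory Set Filter Topology

lemma aux_lower (β : ℝ) (hβ1 : 1 < β) (ψ : ℝ → ℝ)
    (hpos : ∀ p : ℝ, p ≠ 0 → 0 < ψ p)
    (hRV : ∀ l : ℝ, 0 < l → Tendsto (fun x => ψ (l * x) / ψ x) atTop (nhds (l ^ β)))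
    (hdiff1 : ∀ p : ℝ, 0 < p → DifferentiableAt ℝ ψ p) :
    ∃ X c γ : ℝ, 1 ≤ X ∧ 0 < c ∧ 1 < γ ∧ ∀ p, X ≤ p → c * p ^ γ ≤ ψ p := by
  obtain ⟨γ, hγ1, hγβ⟩ := exists_between hβ1
  have h1 : (2:ℝ) ^ γ < 2 ^ β := Real.rpow_lt_rpow_of_exponent_lt (by norm_num) hγβ
  have h2 := (hRV 2 (by norm_num)).eventually (lt_mem_nhds h1)
  obtain ⟨X0, hX0⟩ := eventually_atTop.1 h2
  set X := max X0 1 with hX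
  have hX1 : 1 ≤ X := le_max_right _ _
  have hXpos : 0 < X := by linarith
  have hstep : ∀ x, X ≤ x → 2 ^ γ * ψ x ≤ ψ (2 * x) := by
    intro x hx
    have hx0 : 0 < x := by linarith
    have := hX0 x (le_trans (le_max_left _ _) hx)
    exact ((lt_div_iff₀ (hpos x hx0.ne')).1 this).le
  have hcont : ContinuousOn ψ (Icc X (2 * X)) := fun p hp =>
    (hdiff1 p (by linarith [hp.1])).continuousAt.continuousWithinAt
  obtain ⟨y, hy, hmin⟩ := isCompact_Icc.exists_isMinOn ⟨X, ⟨le_rfl, by linarith⟩⟩ hcont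
  have hm : 0 < ψ y := hpos y (by linarith [hy.1])
  have h2X : 0 < (2 * X) ^ γ := Real.rpow_pos_of_pos (by linarith) _
  refine ⟨X, ψ y / (2 * X) ^ γ, γ, hX1, by positivity, hγ1, ?_⟩
  have key : ∀ n : ℕ, ∀ p, X ≤ p → p ≤ 2 ^ (n + 1) * X → ψ y / (2 * X) ^ γ * p ^ γ ≤ ψ p := by
    intro n
    have base : ∀ p, X ≤ p → p ≤ 2 * X → ψ y / (2 * X) ^ γ * p ^ γ ≤ ψ p := by
      intro p hp hp2
      have h3 : ψ y ≤ ψ p := hmin ⟨hp, hp2⟩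
      have h4 : p ^ γ ≤ (2 * X) ^ γ := Real.rpow_le_rpow (by linarith) hp2 (by linarith)
      calc ψ y / (2 * X) ^ γ * p ^ γ ≤ ψ y / (2 * X) ^ γ * (2 * X) ^ γ := by gcongr
        _ = ψ y := by field_simp
        _ ≤ _ := h3
    induction n with
    | zero => intro p hp hp2; exact base p hp (by simpa using hp2)
    | succ n ih =>
      intro p hp hp2
      rcases le_total p (2 * X) with h | h
      · exact base p hp h
      · have h5 := ih (p / 2) (by linarith) (by rw [pow_succ] at hp2; linarith)
        have h6 := hstep (p / 2) (by linarith)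
        have h7 : p ^ γ = 2 ^ γ * (p / 2) ^ γ := by
          rw [← Real.mul_rpow (by norm_num) (by linarith)]; congr 1; ring
        rw [show 2 * (p / 2) = p by ring] at h6
        rw [h7]
        refine le_trans ?_ h6
        have : (0:ℝ) < 2 ^ γ := by positivity
        nlinarith
  intro p hp
  obtain ⟨n, hn⟩ := pow_unbounded_of_one_lt p (by norm_num : (1:ℝ) < 2)
  refine key n p hp ?_
  rw [pow_succ]
  have : (0:ℝ) < 2 ^ n := by positivity
  nlinarith

lemma aux_rpow_exp {t a : ℝ} (ht : 0 < t) (ha0 : 0 < a) (ha1 : a < 1) :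
    Real.exp (-t) ≤ t ^ (-a) := by
  rw [Real.exp_neg, Real.rpow_neg ht.le]
  refine inv_anti₀ (Real.rpow_pos_of_pos ht _) ?_
  rcases le_total t 1 with h | h
  · exact (Real.rpow_le_one ht.le h ha0.le).trans (Real.one_le_exp ht.le)
  · calc t ^ a ≤ t ^ (1:ℝ) := Real.rpow_le_rpow_of_exponent_le h ha1.le
      _ = t := Real.rpow_one t
      _ ≤ _ := by linarith [Real.add_one_le_exp t]

lemma aux_G (ψ : ℝ → ℝ) (hnonneg : ∀ p : ℝ, 0 ≤ ψ p) (X c γ : ℝ) (hX : 1 ≤ X) (hc : 0 < c)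
    (hγ : 1 < γ) (hlow : ∀ p, X ≤ p → c * p ^ γ ≤ ψ p) :
    ∃ (G : ℝ → ℝ) (a : ℝ), a < 1 ∧ IntegrableOn G (Ioi 0) ∧
      ∀ s, 0 < s → s ≤ 1 → ∀ p, 0 < p → Real.exp (-s * ψ p) ≤ s ^ (-a) * G p := by
  obtain ⟨a, ha1, ha2⟩ := exists_between (inv_lt_one_of_one_lt₀ hγ)
  have ha0 : 0 < a := lt_trans (by positivity) ha1
  have haγ : 1 < γ * a := by
    have := (inv_lt_iff_one_lt_mul₀ (by linarith : 0 < γ)).1 ha1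
    linarith
  refine ⟨fun p => if p ≤ X then 1 else c ^ (-a) * p ^ (-(γ * a)), a, ha2, ?_, ?_⟩
  · rw [← Ioc_union_Ioi_eq_Ioi (by linarith : (0:ℝ) ≤ X)]
    refine IntegrableOn.union ?_ ?_
    · refine IntegrableOn.congr_fun (f := fun _ => (1:ℝ)) (by simp) ?_ measurableSet_Ioc
      intro p hp; simp [hp.2]
    · refine IntegrableOn.congr_fun (f := fun p => c ^ (-a) * p ^ (-(γ * a)))
        ((integrableOn_Ioi_rpow_of_lt (by linarith) (by linarith)).const_mul _) ?_ measurableSet_Ioi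
      intro p hp; simp [not_le.2 (mem_Ioi.1 hp)]
  · intro s hs hs1 p hp
    dsimp only
    have hs2 : 1 ≤ s ^ (-a) := Real.one_le_rpow_of_pos_of_le_one_of_nonpos hs hs1 (by linarith)
    split_ifs with h
    · have : Real.exp (-s * ψ p) ≤ 1 := Real.exp_le_one_iff.2 (by nlinarith [hnonneg p])
      linarith
    · have h1 := hlow p (not_le.1 h).le
      have hp' : 0 < p ^ γ := Real.rpow_pos_of_pos hp _
      have h2 : Real.exp (-s * ψ p) ≤ Real.exp (-(s * (c * p ^ γ))) := by
        apply Real.exp_le_exp.2; nlinarith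
      refine h2.trans ((aux_rpow_exp (by positivity) ha0 ha2).trans (le_of_eq ?_))
      rw [Real.mul_rpow hs.le (by positivity), Real.mul_rpow hc.le hp'.le, ← Real.rpow_mul hp.le]
      ring_nf

lemma aux_L (ψ : ℝ → ℝ) (hdiff2 : ∀ p : ℝ, 0 < p → DifferentiableAt ℝ (deriv ψ) p)
    (hint2 : IntegrableOn (fun l : ℝ => |deriv (deriv ψ) l|) (Ioc (0:ℝ) 1)) :
    ∃ L, Tendsto (deriv ψ) (𝓝[>] 0) (𝓝 L) := by
  have hi : IntegrableOn (deriv (deriv ψ)) (Ioc (0:ℝ) 1) := by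
    refine (integrable_norm_iff (measurable_deriv _).aestronglyMeasurable).1 ?_
    exact hint2
  have hii : IntervalIntegrable (deriv (deriv ψ)) volume 0 1 :=
    (intervalIntegrable_iff_integrableOn_Ioc_of_le zero_le_one).2 hi
  have hc := intervalIntegral.continuousOn_primitive_interval' (a := 1) hii (by simp)
  have h0 : ContinuousWithinAt (fun b => ∫ x in (1:ℝ)..b, deriv (deriv ψ) x) (uIcc 0 1) 0 :=
    hc 0 (by simp)
  have h1 := h0.tendsto.mono_left (nhdsWithin_mono (0:ℝ) (s := Ioc 0 1)
    (by rw [uIcc_of_le zero_le_one]; exact Ioc_subset_Icc_self))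
  rw [nhdsWithin_Ioc_eq_nhdsGT zero_lt_one] at h1
  refine ⟨_, ((h1.const_add (deriv ψ 1))).congr' ?_⟩
  filter_upwards [Ioc_mem_nhdsGT (zero_lt_one (α := ℝ))] with p hp
  have := intervalIntegral.integral_eq_sub_of_hasDerivAt (a := 1) (b := p) (f := deriv ψ)
    (f' := deriv (deriv ψ)) (fun x hx => by
      rw [uIcc_of_ge hp.2] at hx
      exact (hdiff2 x (lt_of_lt_of_le hp.1 hx.1)).hasDerivAt)
    (hii.mono_set (by rw [uIcc_of_ge hp.2, uIcc_of_le zero_le_one]; exact Icc_subset_Icc_left hp.1.le))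
  rw [this]; ring

lemma aux_exp1 {t : ℝ} (ht : 0 ≤ t) : t * Real.exp (-t) ≤ 1 := by
  rw [Real.exp_neg, ← div_eq_mul_inv, div_le_one (Real.exp_pos _)]
  linarith [Real.add_one_le_exp t]

lemma aux_exp2 {t : ℝ} (ht : 0 ≤ t) : t ^ 2 * Real.exp (-t) ≤ 2 := by
  rw [Real.exp_neg, ← div_eq_mul_inv, div_le_iff₀ (Real.exp_pos _)]
  linarith [Real.quadratic_le_exp_of_nonneg ht]

lemma aux_H (ψ : ℝ → ℝ) (hnonneg : ∀ p : ℝ, 0 ≤ ψ p) (D₁ D₂ : ℝ)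
    (hD1 : ∀ l : ℝ, 1 ≤ l → l * |deriv ψ l| ≤ D₁ * ψ l)
    (hD2 : ∀ l : ℝ, 1 ≤ l → l ^ 2 * |deriv (deriv ψ) l| ≤ D₂ * ψ l)
    (hint1 : IntegrableOn (fun l : ℝ => (deriv ψ l) ^ 2) (Ioc (0:ℝ) 1))
    (hint2 : IntegrableOn (fun l : ℝ => |deriv (deriv ψ) l|) (Ioc (0:ℝ) 1)) :
    ∃ H : ℝ → ℝ, IntegrableOn H (Ioi 0) ∧ ∀ s, 0 < s → s ≤ 1 → ∀ p, 0 < p →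
      |(s * deriv (deriv ψ) p - s ^ 2 * (deriv ψ p) ^ 2) * Real.exp (-s * ψ p)| ≤ H p := by
  refine ⟨fun p => if p ≤ 1 then (deriv ψ p) ^ 2 + |deriv (deriv ψ) p|
    else (2 * D₁ ^ 2 + |D₂|) * p ^ (-2:ℝ), ?_, ?_⟩
  · rw [← Ioc_union_Ioi_eq_Ioi (zero_le_one (α := ℝ))]
    refine IntegrableOn.union ?_ ?_
    · refine IntegrableOn.congr_fun (hint1.add hint2) ?_ measurableSet_Ioc
      intro p hp; simp [hp.2]
    · refine IntegrableOn.congr_fun (f := fun p => (2 * D₁ ^ 2 + |D₂|) * p ^ (-2:ℝ))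
        ((integrableOn_Ioi_rpow_of_lt (by norm_num) (by norm_num)).const_mul _) ?_ measurableSet_Ioi
      intro p hp; simp [not_le.2 (mem_Ioi.1 hp)]
  · intro s hs hs1 p hp
    dsimp only
    have htri : |s * deriv (deriv ψ) p - s ^ 2 * (deriv ψ p) ^ 2| ≤
        s * |deriv (deriv ψ) p| + s ^ 2 * (deriv ψ p) ^ 2 := by
      refine (abs_sub _ _).trans (le_of_eq ?_)
      rw [abs_mul, abs_of_pos hs, abs_of_nonneg (by positivity : 0 ≤ s ^ 2 * (deriv ψ p) ^ 2)]
    rw [abs_mul, abs_of_pos (Real.exp_pos _)]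
    have hE := Real.exp_pos (-s * ψ p)
    split_ifs with h
    · have hE1 : Real.exp (-s * ψ p) ≤ 1 := Real.exp_le_one_iff.2 (by nlinarith [hnonneg p])
      calc _ ≤ |s * deriv (deriv ψ) p - s ^ 2 * (deriv ψ p) ^ 2| * 1 := by gcongr
        _ ≤ s * |deriv (deriv ψ) p| + s ^ 2 * (deriv ψ p) ^ 2 := by rw [mul_one]; exact htri
        _ ≤ 1 * |deriv (deriv ψ) p| + 1 ^ 2 * (deriv ψ p) ^ 2 := by gcongr
        _ = _ := by ring
    · push Not at h
      have e1 := hD1 p h.le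
      have e2 := hD2 p h.le
      have hψ := hnonneg p
      have f1 : p ^ 2 * (deriv ψ p) ^ 2 ≤ D₁ ^ 2 * ψ p ^ 2 := by
        have := pow_le_pow_left₀ (by positivity) e1 2
        rwa [mul_pow, mul_pow, sq_abs] at this
      have f2 : p ^ 2 * |deriv (deriv ψ) p| ≤ |D₂| * ψ p :=
        e2.trans (mul_le_mul_of_nonneg_right (le_abs_self _) hψ)
      have t0 : 0 ≤ s * ψ p := by positivity
      have g1 := aux_exp1 t0
      have g2 := aux_exp2 t0
      rw [← neg_mul] at g1 g2
      have hp2 : p ^ (-2:ℝ) = (p ^ 2)⁻¹ := by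
        rw [Real.rpow_neg hp.le]; norm_num
      rw [hp2, ← div_eq_mul_inv, le_div_iff₀ (by positivity)]
      calc _ ≤ (s * |deriv (deriv ψ) p| + s ^ 2 * (deriv ψ p) ^ 2) * Real.exp (-s * ψ p) * p ^ 2 := by
            gcongr
        _ = (s * (p ^ 2 * |deriv (deriv ψ) p|) + s ^ 2 * (p ^ 2 * (deriv ψ p) ^ 2))
              * Real.exp (-s * ψ p) := by ring
        _ ≤ (s * (|D₂| * ψ p) + s ^ 2 * (D₁ ^ 2 * ψ p ^ 2)) * Real.exp (-s * ψ p) := by gcongr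
        _ = |D₂| * (s * ψ p * Real.exp (-s * ψ p))
              + D₁ ^ 2 * ((s * ψ p) ^ 2 * Real.exp (-s * ψ p)) := by ring
        _ ≤ |D₂| * 1 + D₁ ^ 2 * 2 := by gcongr
        _ = _ := by ring

lemma aux_ibp (ψ : ℝ → ℝ) (hmeas : Measurable ψ) (hnonneg : ∀ p : ℝ, 0 ≤ ψ p)
    (hdiff1 : ∀ p : ℝ, 0 < p → DifferentiableAt ℝ ψ p)
    (hdiff2 : ∀ p : ℝ, 0 < p → DifferentiableAt ℝ (deriv ψ) p)
    (D₁ : ℝ) (hD1 : ∀ l : ℝ, 1 ≤ l → l * |deriv ψ l| ≤ D₁ * ψ l)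
    (C₀ : ℝ) (hC0 : ∀ p : ℝ, ψ p ≤ C₀ * p ^ 2)
    (hinf : Tendsto ψ atTop atTop)
    (L : ℝ) (hL : Tendsto (deriv ψ) (𝓝[>] 0) (𝓝 L))
    (s : ℝ) (hs : 0 < s) (hs1 : s ≤ 1)
    (hE : IntegrableOn (fun p => Real.exp (-s * ψ p)) (Ioi 0))
    (H : ℝ → ℝ) (hH : IntegrableOn H (Ioi 0)) (hHb : ∀ p, 0 < p →
      |(s * deriv (deriv ψ) p - s ^ 2 * (deriv ψ p) ^ 2) * Real.exp (-s * ψ p)| ≤ H p)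
    (x : ℝ) (hx : x ≠ 0) :
    x ^ 2 * |∫ p in Ioi (0:ℝ), Real.cos (p * x) * Real.exp (-s * ψ p)|
      ≤ |L| + ∫ p in Ioi (0:ℝ), H p := by
  set E : ℝ → ℝ := fun p => Real.exp (-s * ψ p) with hEdef
  set Q : ℝ → ℝ := fun p => (s * deriv (deriv ψ) p - s ^ 2 * (deriv ψ p) ^ 2) * E p with hQ
  have hEm : Measurable E := by fun_prop
  have hQm : Measurable Q := by
    have := measurable_deriv ψ
    have := measurable_deriv (deriv ψ)
    fun_prop
  have hcosm : Measurable (fun p : ℝ => Real.cos (p * x)) := by fun_prop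
  have i1 : IntegrableOn (fun p => Real.cos (p * x) * E p) (Ioi 0) := by
    refine Integrable.mono' hE (hcosm.mul hEm).aestronglyMeasurable (Eventually.of_forall fun p => ?_)
    rw [norm_mul, Real.norm_eq_abs, Real.norm_eq_abs, abs_of_pos (Real.exp_pos _)]
    exact mul_le_of_le_one_left (Real.exp_pos _).le (Real.abs_cos_le_one _)
  have b2 : ∀ᵐ p ∂(volume.restrict (Ioi (0:ℝ))), ‖Real.cos (p * x) * Q p‖ ≤ H p := by
    filter_upwards [ae_restrict_mem measurableSet_Ioi] with p hp
    rw [norm_mul, Real.norm_eq_abs, Real.norm_eq_abs]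
    exact (mul_le_of_le_one_left (abs_nonneg _) (Real.abs_cos_le_one _)).trans (hHb p hp)
  have i2 : IntegrableOn (fun p => Real.cos (p * x) * Q p) (Ioi 0) :=
    Integrable.mono' hH (hcosm.mul hQm).aestronglyMeasurable b2
  let F : ℝ → ℝ := fun p => x * Real.sin (p * x) * E p - Real.cos (p * x) * (s * deriv ψ p * E p)
  have hF : ∀ p ∈ Ioi (0:ℝ), HasDerivAt F
      (x ^ 2 * (Real.cos (p * x) * E p) - Real.cos (p * x) * Q p) p := by
    intro p hp
    have d1 := (hdiff1 p hp).hasDerivAt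
    have d2 := (hdiff2 p hp).hasDerivAt
    have dl : HasDerivAt (fun p : ℝ => p * x) x p := by simpa using (hasDerivAt_id p).mul_const x
    have dE : HasDerivAt E (E p * (-s * deriv ψ p)) p := (d1.const_mul (-s)).exp
    have := ((dl.sin.const_mul x).mul dE).sub (dl.cos.mul ((d2.const_mul s).mul dE))
    refine HasDerivAt.congr_deriv this ?_
    have hQp : Q p = (s * deriv (deriv ψ) p - s ^ 2 * (deriv ψ p) ^ 2) * E p := rfl
    rw [hQp]
    simp only [Pi.mul_apply]
    ring
  have hz : Tendsto F (𝓝[>] 0) (𝓝 (-(s * L))) := by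
    have hψ0 : Tendsto ψ (𝓝[>] 0) (𝓝 0) := by
      refine squeeze_zero hnonneg hC0 ?_
      have : Continuous fun p : ℝ => C₀ * p ^ 2 := by fun_prop
      have := this.tendsto 0
      simp only [ne_eq, OfNat.ofNat_ne_zero, not_false_eq_true, zero_pow, mul_zero] at this
      exact this.mono_left nhdsWithin_le_nhds
    have tE : Tendsto E (𝓝[>] 0) (𝓝 1) := by
      have := (Real.continuous_exp.tendsto _).comp (hψ0.const_mul (-s))
      simpa [Function.comp_def, hEdef] using this
    have ts : Tendsto (fun p : ℝ => x * Real.sin (p * x)) (𝓝[>] 0) (𝓝 0) := by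
      have : Continuous fun p : ℝ => x * Real.sin (p * x) := by fun_prop
      have := this.tendsto 0
      simp only [zero_mul, Real.sin_zero, mul_zero] at this
      exact this.mono_left nhdsWithin_le_nhds
    have tc : Tendsto (fun p : ℝ => Real.cos (p * x)) (𝓝[>] 0) (𝓝 1) := by
      have : Continuous fun p : ℝ => Real.cos (p * x) := by fun_prop
      have := this.tendsto 0
      simp only [zero_mul, Real.cos_zero] at this
      exact this.mono_left nhdsWithin_le_nhds
    have := (ts.mul tE).sub (tc.mul ((hL.const_mul s).mul tE))
    simpa using this
  have hi : Tendsto F atTop (𝓝 0) := by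
    have tE : Tendsto E atTop (𝓝 0) := by
      refine Real.tendsto_exp_atBot.comp ?_
      exact hinf.const_mul_atTop_of_neg (by linarith)
    have u1 : Tendsto (fun p => |x| * E p + |D₁| * p⁻¹) atTop (𝓝 0) := by
      have := (tE.const_mul |x|).add ((tendsto_inv_atTop_zero (𝕜 := ℝ)).const_mul |D₁|)
      simpa using this
    refine squeeze_zero_norm' ?_ u1
    filter_upwards [eventually_ge_atTop (1:ℝ)] with p hp
    have hp0 : 0 < p := by linarith
    have hEp : 0 < E p := Real.exp_pos _
    have hd : |s * deriv ψ p * E p| ≤ |D₁| * p⁻¹ := by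
      rw [← div_eq_mul_inv, le_div_iff₀ hp0, abs_mul, abs_mul, abs_of_pos hs, abs_of_pos hEp]
      have g1 := aux_exp1 (mul_nonneg hs.le (hnonneg p))
      rw [← neg_mul] at g1
      calc s * |deriv ψ p| * E p * p = s * (p * |deriv ψ p|) * E p := by ring
        _ ≤ s * (|D₁| * ψ p) * E p := by
            have := (hD1 p hp).trans (mul_le_mul_of_nonneg_right (le_abs_self D₁) (hnonneg p))
            gcongr
        _ = |D₁| * (s * ψ p * E p) := by ring
        _ ≤ |D₁| * 1 := by gcongr
        _ = |D₁| := mul_one _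
    refine (norm_sub_le _ _).trans (add_le_add ?_ ?_)
    · rw [norm_mul, norm_mul, Real.norm_eq_abs, Real.norm_eq_abs, Real.norm_eq_abs, abs_of_pos hEp]
      gcongr
      exact mul_le_of_le_one_right (abs_nonneg _) (Real.abs_sin_le_one _)
    · rw [norm_mul, Real.norm_eq_abs, Real.norm_eq_abs]
      exact (mul_le_of_le_one_left (abs_nonneg _) (Real.abs_cos_le_one _)).trans hd
  have hFi : IntegrableOn (fun p => x ^ 2 * (Real.cos (p * x) * E p) - Real.cos (p * x) * Q p)
      (Ioi 0) := (i1.const_mul _).sub i2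
  have key := integral_Ioi_deriv_mul_eq_sub (a := 0) (u := F) (v := fun _ => (1:ℝ))
    (u' := fun p => x ^ 2 * (Real.cos (p * x) * E p) - Real.cos (p * x) * Q p)
    (v' := fun _ => (0:ℝ)) (a' := -(s * L)) (b' := 0) hF (fun p _ => hasDerivAt_const p 1)
    (by
      refine hFi.congr_fun ?_ measurableSet_Ioi
      intro p _; simp)
    (by
      refine hz.congr fun p => ?_
      simp)
    (by
      refine hi.congr fun p => ?_
      simp)
  simp only [mul_one, mul_zero, add_zero] at key
  rw [integral_sub (i1.const_mul _) i2, integral_const_mul] at key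
  have hb := norm_integral_le_of_norm_le hH b2
  rw [Real.norm_eq_abs] at hb
  have hsL : |s * L| ≤ |L| := by
    rw [abs_mul, abs_of_pos hs]; exact mul_le_of_le_one_left (abs_nonneg _) hs1
  rw [← abs_of_nonneg (sq_nonneg x), ← abs_mul]
  have : x ^ 2 * ∫ p in Ioi (0:ℝ), Real.cos (p * x) * E p
      = s * L + ∫ p in Ioi (0:ℝ), Real.cos (p * x) * Q p := by linarith
  rw [this]
  exact (abs_add_le _ _).trans (add_le_add hsL hb)

theorem stmt_1
    (β : ℝ) (hβ1 : 1 < β) (hβ2 : β ≤ 2)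
    (ψ : ℝ → ℝ)
    (hmeas : Measurable ψ)
    (heven : ∀ p : ℝ, ψ (-p) = ψ p)
    (hnonneg : ∀ p : ℝ, 0 ≤ ψ p)
    (hpos : ∀ p : ℝ, p ≠ 0 → 0 < ψ p)
    (hRV : ∀ l : ℝ, 0 < l →
      Filter.Tendsto (fun x => ψ (l * x) / ψ x) Filter.atTop (nhds (l ^ β)))
    (hdiff1 : ∀ p : ℝ, 0 < p → DifferentiableAt ℝ ψ p)
    (hdiff2 : ∀ p : ℝ, 0 < p → DifferentiableAt ℝ (deriv ψ) p)
    (D₁ D₂ : ℝ)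
    (hD1 : ∀ l : ℝ, 1 ≤ l → l * |deriv ψ l| ≤ D₁ * ψ l)
    (hD2 : ∀ l : ℝ, 1 ≤ l → l ^ 2 * |deriv (deriv ψ) l| ≤ D₂ * ψ l)
    (hint1 : MeasureTheory.IntegrableOn (fun l : ℝ => (deriv ψ l) ^ 2) (Set.Ioc (0:ℝ) 1))
    (hint2 : MeasureTheory.IntegrableOn (fun l : ℝ => |deriv (deriv ψ) l|) (Set.Ioc (0:ℝ) 1))
    (hint3 : MeasureTheory.IntegrableOn (fun l : ℝ => ψ l / l) (Set.Ioc (0:ℝ) 1))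
    (C₀ : ℝ) (hC0 : ∀ p : ℝ, ψ p ≤ C₀ * p ^ 2)
    (hliminf : 0 < Filter.liminf (fun p : ℝ => ψ p / p ^ 2) (nhdsWithin (0:ℝ) ({0}ᶜ))) :
    ∃ C : ℝ, ∀ x : ℝ, (∫ s in (0:ℝ)..1, pdens ψ s x) ≤ C / (1 + x ^ 2) := by
  obtain ⟨X, c, γ, hX, hc, hγ, hlow⟩ := aux_lower β hβ1 ψ hpos hRV hdiff1
  obtain ⟨G, a, ha, hG, hGb⟩ := aux_G ψ hnonneg X c γ hX hc hγ hlow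
  obtain ⟨L, hL⟩ := aux_L ψ hdiff2 hint2
  obtain ⟨H, hH, hHb⟩ := aux_H ψ hnonneg D₁ D₂ hD1 hD2 hint1 hint2
  have hinf : Tendsto ψ atTop atTop := by
    refine tendsto_atTop_mono' atTop ?_
      ((tendsto_rpow_atTop (by linarith : 0 < γ)).const_mul_atTop hc)
    filter_upwards [eventually_ge_atTop X] with p hp using hlow p hp
  have hEm : ∀ s : ℝ, Measurable fun p => Real.exp (-s * ψ p) := fun s => by fun_prop
  have hE : ∀ s, 0 < s → s ≤ 1 → IntegrableOn (fun p => Real.exp (-s * ψ p)) (Ioi 0) := by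
    intro s hs hs1
    refine Integrable.mono' (hG.const_mul (s ^ (-a))) (hEm s).aestronglyMeasurable ?_
    filter_upwards [ae_restrict_mem measurableSet_Ioi] with p hp
    rw [Real.norm_eq_abs, abs_of_pos (Real.exp_pos _)]
    exact hGb s hs hs1 p hp
  have hpi : |1 / Real.pi| ≤ 1 := by
    rw [abs_of_pos (by positivity), div_le_one Real.pi_pos]
    linarith [Real.pi_gt_three]
  -- bounded
  have A1 : ∀ x, |∫ s in (0:ℝ)..1, pdens ψ s x| ≤
      ∫ s in (0:ℝ)..1, s ^ (-a) * ∫ p in Ioi (0:ℝ), G p := by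
    intro x
    rw [← Real.norm_eq_abs]
    refine intervalIntegral.norm_integral_le_of_norm_le zero_le_one (Eventually.of_forall ?_)
      ((intervalIntegral.intervalIntegrable_rpow' (by linarith)).mul_const _)
    intro s hs
    rw [pdens, norm_mul, ← integral_const_mul]
    refine (mul_le_of_le_one_left (norm_nonneg _) hpi).trans ?_
    refine norm_integral_le_of_norm_le (hG.const_mul _) ?_
    filter_upwards [ae_restrict_mem measurableSet_Ioi] with p hp
    rw [norm_mul, Real.norm_eq_abs, Real.norm_eq_abs, abs_of_pos (Real.exp_pos _)]
    exact (mul_le_of_le_one_left (Real.exp_pos _).le (Real.abs_cos_le_one _)).trans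
      (hGb s hs.1 hs.2 p hp)
  have A2 : ∀ x, x ≠ 0 → |∫ s in (0:ℝ)..1, pdens ψ s x| ≤
      (|L| + ∫ p in Ioi (0:ℝ), H p) / x ^ 2 := by
    intro x hx
    have := intervalIntegral.norm_integral_le_of_norm_le_const (a := 0) (b := 1)
      (f := fun s => pdens ψ s x) (C := (|L| + ∫ p in Ioi (0:ℝ), H p) / x ^ 2) (by
        intro s hs
        rw [uIoc_of_le zero_le_one] at hs
        have hx2 : 0 < x ^ 2 := by positivity
        rw [pdens, norm_mul, le_div_iff₀ hx2]
        have h1 := aux_ibp ψ hmeas hnonneg hdiff1 hdiff2 D₁ hD1 C₀ hC0 hinf L hL s hs.1 hs.2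
          (hE s hs.1 hs.2) H hH (hHb s hs.1 hs.2) x hx
        have h2 := mul_le_of_le_one_left (norm_nonneg
          (∫ p in Ioi (0:ℝ), Real.cos (p * x) * Real.exp (-s * ψ p))) hpi
        rw [mul_comm]
        exact (mul_le_mul_of_nonneg_left h2 hx2.le).trans h1)
    simpa using this
  refine ⟨(∫ s in (0:ℝ)..1, s ^ (-a) * ∫ p in Ioi (0:ℝ), G p) + (|L| + ∫ p in Ioi (0:ℝ), H p), ?_⟩
  intro x
  have hx1 : 0 < 1 + x ^ 2 := by positivity
  have hLH : 0 ≤ |L| + ∫ p in Ioi (0:ℝ), H p := by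
    have := (abs_nonneg _).trans (A2 1 one_ne_zero)
    simpa using this
  rw [le_div_iff₀ hx1]
  have h1 := A1 x
  have h0 := le_abs_self (∫ s in (0:ℝ)..1, pdens ψ s x)
  by_cases hx : x = 0
  · subst hx
    simp only [ne_eq, OfNat.ofNat_ne_zero, not_false_eq_true, zero_pow, add_zero, mul_one]
    linarith
  · have h2 := A2 x hx
    rw [le_div_iff₀ (by positivity)] at h2
    have : (∫ s in (0:ℝ)..1, pdens ψ s x) * (1 + x ^ 2) ≤
      |∫ s in (0:ℝ)..1, pdens ψ s x| * (1 + x ^ 2) := by gcongr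
    linarith
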